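/- arXiv:1903.04231 — 3 statements merged into one kernel-verified Lean document; each statement's English description precedes it below -/
import Mathlib

section
/- For every 1 ≤ k ≤ n, the function λ ↦ (S_k(λ))^{1/k} is concave on the Gårding cone Γ_k ⊆ ℝ^n; that is, for all λ, μ ∈ Γ_k and t ∈ [0,1], S_k(tλ + (1−t)μ)^{1/k} ≥ t S_k(λ)^{1/k} + (1−t) S_k(μ)^{1/k}. -/
open Finset

noncomputable section

/-- The `k`-th elementary symmetric function of a finite family of reals. -/
def S {ι : Type*} [Fintype ι] (k : ℕ) (lam : ι → ℝ) : ℝ :=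
  ∑ s ∈ Finset.univ.powersetCard k, ∏ i ∈ s, lam i

/-- The Gårding cone `Γ_k` in `ℝ^ι`. -/
def Gamma (ι : Type*) [Fintype ι] (k : ℕ) : Set (ι → ℝ) :=
  {lam | ∀ i : ℕ, 1 ≤ i → i ≤ k → 0 < S i lam}

/-- Increasing multi-indices of length `m` from `{1,…,n}`, i.e. `m`-element subsets of `Fin n`. -/
abbrev MIdx (n m : ℕ) := {s : Finset (Fin n) // s.card = m}

/-- The vector of all `m`-fold sums of the entries of `μ`. -/
def sumVec (n m : ℕ) (μ : Fin n → ℝ) : MIdx n m → ℝ := fun s => ∑ i ∈ s.1, μ i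

/-- The generalized Gårding cone `Γ_k^{(m)}`. -/
def GammaGen (n m k : ℕ) : Set (Fin n → ℝ) :=
  {μ | sumVec n m μ ∈ Gamma (MIdx n m) k}

/-- The `W`-matrix of a symmetric `n × n` matrix `A`. -/
def Wmat {n : ℕ} (m : ℕ) (A : Matrix (Fin n) (Fin n) ℝ) :
    Matrix (MIdx n m) (MIdx n m) ℝ := fun α β =>
  if α = β then ∑ i ∈ α.1, A i i
  else if (α.1 \ β.1).card = 1 then
    ∑ i ∈ α.1 \ β.1, ∑ j ∈ β.1 \ α.1,
      (-1 : ℝ) ^ (Nat.dist ((α.1.filter (fun a => a < i)).card)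
                           ((β.1.filter (fun b => b < j)).card)) * A i j
  else 0

/-- `S_k` of a matrix, as the sum of its `k × k` principal minors
(equal to `S_k` of the eigenvalues for symmetric matrices). -/
def Smat {ι : Type*} [Fintype ι] [DecidableEq ι] (k : ℕ) (M : Matrix ι ι ℝ) : ℝ :=
  ∑ s ∈ Finset.univ.powersetCard k,
    (M.submatrix (Subtype.val : {x // x ∈ s} → ι) (Subtype.val : {x // x ∈ s} → ι)).det

abbrev E (n : ℕ) := EuclideanSpace ℝ (Fin n)

/-- The Hessian matrix of `u` at `x`. -/
def hess (n : ℕ) (u : E n → ℝ) (x : E n) : Matrix (Fin n) (Fin n) ℝ :=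
  fun i j => iteratedFDeriv ℝ 2 u x ![EuclideanSpace.single i 1, EuclideanSpace.single j 1]


open Polynomial in
/-- If a real polynomial has only real roots, so does its derivative. -/
theorem splits_derivative {p : ℝ[X]} (hp : p.Splits) : (derivative p).Splits := by
  rw [Polynomial.splits_iff_card_roots] at hp ⊢
  have h1 := Polynomial.card_roots_le_derivative p
  have h2 := Polynomial.card_roots' (derivative p)
  have h3 := Polynomial.natDegree_derivative_le p
  omega

open Polynomial in
/-- Newton's inequality for the three lowest coefficients of a real-rooted polynomial. -/
theorem newton_coeff {p : ℝ[X]} (hp : p.Splits) :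
    2 * (p.coeff 0 * p.coeff 2) ≤ p.coeff 1 ^ 2 := by
  obtain ⟨m, hm⟩ := Polynomial.splits_iff_exists_multiset.1 hp
  have key : 2 * ((m.map (X - C ·)).prod.coeff 0 * (m.map (X - C ·)).prod.coeff 2) ≤
      (m.map (X - C ·)).prod.coeff 1 ^ 2 := by
    clear hm
    induction m using Multiset.induction_on with
    | empty => simp [Polynomial.coeff_one]
    | cons r m ih =>
      rw [Multiset.map_cons, Multiset.prod_cons]
      generalize (m.map (X - C ·)).prod = f at ih ⊢
      have h1 : (X * f).coeff 1 = f.coeff 0 := coeff_X_mul f 0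
      have h2 : (X * f).coeff 2 = f.coeff 1 := coeff_X_mul f 1
      simp only [sub_mul, coeff_sub, coeff_C_mul, coeff_X_mul_zero, h1, h2]
      nlinarith [mul_le_mul_of_nonneg_left ih (sq_nonneg r), sq_nonneg (f.coeff 0)]
  rw [hm]
  simp only [coeff_C_mul]
  nlinarith [mul_le_mul_of_nonneg_left key (sq_nonneg p.leadingCoeff)]

/-- The `k`-th elementary symmetric function of the subfamily indexed by `s`. -/
def elemSymm {ι : Type*} (s : Finset ι) (k : ℕ) (x : ι → ℝ) : ℝ :=
  ∑ t ∈ s.powersetCard k, ∏ i ∈ t, x i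

@[simp] theorem elemSymm_zero {ι : Type*} (s : Finset ι) (x : ι → ℝ) : elemSymm s 0 x = 1 := by
  simp [elemSymm]

theorem elemSymm_one {ι : Type*} (s : Finset ι) (x : ι → ℝ) : elemSymm s 1 x = ∑ i ∈ s, x i := by
  simp [elemSymm, Finset.powersetCard_one]

theorem sub_sq_div_add_le {a b p q r : ℝ} (hp : 0 < a + p) (hq : 0 < b + q) (hr : p + q ≤ r) :
    (a - a ^ 2 / (a + p)) + (b - b ^ 2 / (b + q)) ≤ (a + b) - (a + b) ^ 2 / (a + b + r) := by
  have h1 : (a + b) ^ 2 / (a + b + r) ≤ (a + b) ^ 2 / ((a + p) + (b + q)) :=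
    div_le_div_of_nonneg_left (sq_nonneg _) (by linarith) (by linarith)
  have h2 : (a + b) ^ 2 / ((a + p) + (b + q)) ≤ a ^ 2 / (a + p) + b ^ 2 / (b + q) := by
    rw [div_add_div _ _ hp.ne' hq.ne', div_le_div_iff₀ (by linarith) (mul_pos hp hq)]
    nlinarith [sq_nonneg (a * (b + q) - b * (a + p))]
  linarith

section elemSymm

variable {ι : Type*} [DecidableEq ι]

theorem elemSymm_insert {s : Finset ι} {i : ι} (hi : i ∉ s) (k : ℕ) (x : ι → ℝ) :
    elemSymm (insert i s) (k + 1) x = elemSymm s (k + 1) x + x i * elemSymm s k x := by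
  have hmem : ∀ t ∈ s.powersetCard k, i ∉ t := fun t ht h =>
    hi ((Finset.mem_powersetCard.1 ht).1 h)
  unfold elemSymm
  rw [Finset.powersetCard_succ_insert hi, Finset.sum_union, Finset.sum_image, Finset.mul_sum]
  · congr 1
    exact Finset.sum_congr rfl fun t ht => Finset.prod_insert (hmem t ht)
  · intro t ht u hu h
    rw [← Finset.erase_insert (hmem t ht), ← Finset.erase_insert (hmem u hu), h]
  · rw [Finset.disjoint_left]
    intro t ht ht'
    obtain ⟨u, -, rfl⟩ := Finset.mem_image.1 ht'
    exact hi ((Finset.mem_powersetCard.1 ht).1 (Finset.mem_insert_self i u))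

theorem elemSymm_eq_erase {s : Finset ι} {i : ι} (hi : i ∈ s) (k : ℕ) (x : ι → ℝ) :
    elemSymm s (k + 1) x =
      elemSymm (s.erase i) (k + 1) x + x i * elemSymm (s.erase i) k x := by
  conv_lhs => rw [← Finset.insert_erase hi]
  exact elemSymm_insert (Finset.notMem_erase i s) k x

/-- Euler's identity for elementary symmetric functions. -/
theorem succ_mul_elemSymm_succ (s : Finset ι) (k : ℕ) (x : ι → ℝ) :
    (k + 1) * elemSymm s (k + 1) x = ∑ i ∈ s, x i * elemSymm (s.erase i) k x := by
  induction s using Finset.induction_on generalizing k with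
  | empty =>
    rw [Finset.sum_empty, elemSymm, Finset.powersetCard_eq_empty.2 (by simp)]
    simp
  | insert a s ha ih =>
    rw [Finset.sum_insert ha, Finset.erase_insert ha, elemSymm_insert ha]
    have herase : ∀ i ∈ s, (insert a s).erase i = insert a (s.erase i) := fun i hi =>
      Finset.erase_insert_of_ne (by rintro rfl; exact ha hi)
    have hnot : ∀ i, a ∉ s.erase i := fun i h => ha (Finset.mem_of_mem_erase h)
    cases k with
    | zero => simp [elemSymm_one, add_comm]
    | succ j =>
      have h : ∑ i ∈ s, x i * elemSymm ((insert a s).erase i) (j + 1) x =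
          ∑ i ∈ s, x i * elemSymm (s.erase i) (j + 1) x +
            x a * ∑ i ∈ s, x i * elemSymm (s.erase i) j x := by
        rw [Finset.mul_sum, ← Finset.sum_add_distrib]
        refine Finset.sum_congr rfl fun i hi => ?_
        rw [herase i hi, elemSymm_insert (hnot i)]
        ring
      rw [h, ← ih, ← ih]
      push_cast
      ring

open Polynomial in
theorem coeff_prod_one_add (s : Finset ι) (k : ℕ) (x : ι → ℝ) :
    (∏ i ∈ s, (1 + C (x i) * X : ℝ[X])).coeff k = elemSymm s k x := by
  induction s using Finset.induction_on generalizing k with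
  | empty =>
    cases k with
    | zero => simp
    | succ k =>
      rw [elemSymm, Finset.powersetCard_eq_empty.2 (by simp)]
      simp [Polynomial.coeff_one]
  | insert a s ha ih =>
    rw [Finset.prod_insert ha, add_mul, one_mul, mul_assoc, coeff_add, coeff_C_mul]
    cases k with
    | zero => simp [ih]
    | succ k => rw [coeff_X_mul, ih, ih, elemSymm_insert ha]

open Polynomial in
/-- Newton's inequality. -/
theorem newton_elemSymm (s : Finset ι) (k : ℕ) (x : ι → ℝ) :
    (k + 2) * (elemSymm s k x * elemSymm s (k + 2) x) ≤ (k + 1) * elemSymm s (k + 1) x ^ 2 := by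
  have hp : (∏ i ∈ s, (1 + C (x i) * X : ℝ[X])).Splits :=
    Polynomial.Splits.prod fun i _ => Polynomial.Splits.of_natDegree_le_one (by compute_degree)
  have hd : ∀ j, (derivative^[j] (∏ i ∈ s, (1 + C (x i) * X : ℝ[X]))).Splits := by
    intro j
    induction j with
    | zero => exact hp
    | succ j ih =>
      rw [Function.iterate_succ_apply']
      exact splits_derivative ih
  have h := newton_coeff (hd k)
  simp only [coeff_iterate_derivative, coeff_prod_one_add, nsmul_eq_mul] at h
  have h0 : (0 + k).descFactorial k = k.factorial := by
    rw [zero_add, Nat.descFactorial_self]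
  have h1 : (1 + k).descFactorial k = (k + 1) * k.factorial := by
    have := Nat.factorial_mul_descFactorial (show k ≤ 1 + k by omega)
    rw [show 1 + k - k = 1 by omega, Nat.factorial_one, one_mul] at this
    rw [this, add_comm, Nat.factorial_succ]
  have h2 : 2 * (2 + k).descFactorial k = (k + 2) * ((k + 1) * k.factorial) := by
    have := Nat.factorial_mul_descFactorial (show k ≤ 2 + k by omega)
    rw [show 2 + k - k = 2 by omega, Nat.factorial_two] at this
    rw [this, add_comm, Nat.factorial_succ, Nat.factorial_succ]
  have h2' : (2 : ℝ) * ((2 + k).descFactorial k : ℕ) = (k + 2) * ((k + 1) * k.factorial) := by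
    exact_mod_cast h2
  rw [h0, h1, zero_add, add_comm 1 k, add_comm 2 k] at h
  rw [add_comm 2 k] at h2'
  push_cast at h
  have hf : (0 : ℝ) < (k + 1) * (k.factorial : ℝ) ^ 2 := by positivity
  refine le_of_mul_le_mul_left ?_ hf
  calc _ = (k.factorial : ℝ) * elemSymm s k x *
        (((k + 2) * ((k + 1) * k.factorial)) * elemSymm s (k + 2) x) := by ring
    _ ≤ ((k + 1) * k.factorial * elemSymm s (k + 1) x) ^ 2 := by
        rw [← h2']
        linarith
    _ = _ := by ring

/-- Deleting an entry maps `Γ_{k+1}` into `Γ_k`. -/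
theorem elemSymm_erase_pos {s : Finset ι} {i : ι} (hi : i ∈ s) {k : ℕ} {x : ι → ℝ}
    (hx : ∀ j ≤ k + 1, 0 < elemSymm s j x) : 0 < elemSymm (s.erase i) k x := by
  induction k with
  | zero => simp
  | succ k ih =>
    have hk := ih fun j hj => hx j (by omega)
    have h1 := hx (k + 1) (by omega)
    have h2 := hx (k + 2) le_rfl
    rw [elemSymm_eq_erase hi] at h1 h2
    have hn := newton_elemSymm (s.erase i) k x
    by_contra! hneg
    generalize elemSymm (s.erase i) k x = a at *
    generalize elemSymm (s.erase i) (k + 1) x = b at *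
    generalize elemSymm (s.erase i) (k + 1 + 1) x = c at *
    have hxi : 0 < x i := pos_of_mul_pos_left (by linarith) hk.le
    have hc : 0 < c := by nlinarith
    have hac : b ^ 2 < a * c := by
      have e1 : x i * (b ^ 2) ≤ c * (-b) := by nlinarith
      have e2 : c * (-b) < c * (x i * a) := by gcongr; linarith
      have e3 : x i * b ^ 2 < x i * (a * c) := by linarith
      exact lt_of_mul_lt_mul_left e3 hxi.le
    have hk0 : (0 : ℝ) ≤ k := k.cast_nonneg
    nlinarith [mul_pos hk hc]

/-- The quotient of consecutive elementary symmetric functions as a sum of parallel sums. -/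
theorem elemSymm_div_eq_sum (s : Finset ι) (k : ℕ) {x : ι → ℝ}
    (hx : ∀ j ≤ k + 1, 0 < elemSymm s j x) :
    (k + 2) * (elemSymm s (k + 2) x / elemSymm s (k + 1) x) = ∑ i ∈ s,
      (x i - x i ^ 2 / (x i + elemSymm (s.erase i) (k + 1) x / elemSymm (s.erase i) k x)) := by
  have hS := hx (k + 1) le_rfl
  have h := succ_mul_elemSymm_succ s (k + 1) x
  push_cast at h
  rw [← mul_div_assoc, show (k + 2 : ℝ) = k + 1 + 1 by ring, h, Finset.sum_div]
  refine Finset.sum_congr rfl fun i hi => ?_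
  have hE := elemSymm_erase_pos hi hx
  have hr := elemSymm_eq_erase hi k x
  have h3 : x i + elemSymm (s.erase i) (k + 1) x / elemSymm (s.erase i) k x =
      elemSymm s (k + 1) x / elemSymm (s.erase i) k x := by
    rw [hr]
    field_simp
    ring
  rw [h3, div_div_eq_mul_div, eq_sub_iff_add_eq, ← add_div, div_eq_iff hS.ne', hr]
  ring

/-- `Γ_k` is closed under addition and `S_{k+1}/S_k` is superadditive on it. -/
theorem elemSymm_div_superadditive (k : ℕ) (s : Finset ι) {x y : ι → ℝ}
    (hx : ∀ j ≤ k, 0 < elemSymm s j x) (hy : ∀ j ≤ k, 0 < elemSymm s j y) :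
    (∀ j ≤ k, 0 < elemSymm s j (x + y)) ∧
    elemSymm s (k + 1) x / elemSymm s k x + elemSymm s (k + 1) y / elemSymm s k y ≤
      elemSymm s (k + 1) (x + y) / elemSymm s k (x + y) := by
  induction k generalizing s with
  | zero => simp [elemSymm_one, Finset.sum_add_distrib]
  | succ k ih =>
    obtain ⟨hxy, hq⟩ := ih s (fun j hj => hx j (by omega)) fun j hj => hy j (by omega)
    have hadd : ∀ j ≤ k + 1, 0 < elemSymm s j (x + y) := by
      intro j hj
      rcases Nat.lt_or_eq_of_le hj with h | rfl
      · exact hxy j (by omega)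
      · have h1 := div_pos (hx (k + 1) le_rfl) (hx k (by omega))
        have h2 := div_pos (hy (k + 1) le_rfl) (hy k (by omega))
        exact (div_pos_iff_of_pos_right (hxy k le_rfl)).1 (by linarith)
    refine ⟨hadd, ?_⟩
    have hk : (0 : ℝ) < k + 2 := by positivity
    refine le_of_mul_le_mul_left ?_ hk
    rw [mul_add, elemSymm_div_eq_sum s k hx, elemSymm_div_eq_sum s k hy,
      elemSymm_div_eq_sum s k hadd, ← Finset.sum_add_distrib]
    refine Finset.sum_le_sum fun i hi => ?_
    have hpos : ∀ z : ι → ℝ, (∀ j ≤ k + 1, 0 < elemSymm s j z) →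
        0 < z i + elemSymm (s.erase i) (k + 1) z / elemSymm (s.erase i) k z := by
      intro z hz
      have hE := elemSymm_erase_pos hi hz
      have hr := elemSymm_eq_erase hi k z
      have := div_pos (hz (k + 1) le_rfl) hE
      rwa [hr, add_div, mul_div_cancel_right₀ _ hE.ne', add_comm] at this
    exact sub_sq_div_add_le (hpos x hx) (hpos y hy)
      (ih (s.erase i) (fun j hj => elemSymm_erase_pos hi fun l hl => hx l (by omega))
        fun j hj => elemSymm_erase_pos hi fun l hl => hy l (by omega)).2

end elemSymm

/-- Superadditivity of the geometric mean. -/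
theorem geom_mean_superadditive {k : ℕ} (hk : k ≠ 0) {a b : ℕ → ℝ}
    (ha : ∀ j < k, 0 < a j) (hb : ∀ j < k, 0 < b j) :
    (∏ j ∈ range k, a j) ^ (1 / (k : ℝ)) + (∏ j ∈ range k, b j) ^ (1 / (k : ℝ)) ≤
      (∏ j ∈ range k, (a j + b j)) ^ (1 / (k : ℝ)) := by
  have hk' : (k : ℝ) ≠ 0 := Nat.cast_ne_zero.2 hk
  have hab : ∀ j ∈ range k, 0 < a j + b j := fun j hj =>
    add_pos (ha j (mem_range.1 hj)) (hb j (mem_range.1 hj))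
  have hP : 0 < (∏ j ∈ range k, (a j + b j)) ^ (1 / (k : ℝ)) :=
    Real.rpow_pos_of_pos (Finset.prod_pos hab) _
  have amgm : ∀ c : ℕ → ℝ, (∀ j < k, 0 < c j) →
      (∏ j ∈ range k, c j) ^ (1 / (k : ℝ)) / (∏ j ∈ range k, (a j + b j)) ^ (1 / (k : ℝ)) ≤
        ∑ j ∈ range k, 1 / (k : ℝ) * (c j / (a j + b j)) := by
    intro c hc
    have hc' : ∀ j ∈ range k, 0 ≤ c j / (a j + b j) := fun j hj =>
      (div_pos (hc j (mem_range.1 hj)) (hab j hj)).le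
    rw [← Real.div_rpow (Finset.prod_nonneg fun j hj => (hc j (mem_range.1 hj)).le)
      (Finset.prod_pos hab).le, ← Finset.prod_div_distrib, ← Real.finsetProd_rpow _ _ hc']
    exact Real.geom_mean_le_arith_mean_weighted _ (fun _ => 1 / (k : ℝ)) _
      (fun _ _ => by positivity) (by simp [hk']) hc'
  have hsum : ∑ j ∈ range k, 1 / (k : ℝ) * (a j / (a j + b j)) +
      ∑ j ∈ range k, 1 / (k : ℝ) * (b j / (a j + b j)) = 1 := by
    rw [← Finset.sum_add_distrib, Finset.sum_congr rfl (g := fun _ => 1 / (k : ℝ))]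
    · simp [hk']
    · intro j hj
      rw [← mul_add, ← add_div, div_self (hab j hj).ne', mul_one]
  have h := add_le_add (amgm a ha) (amgm b hb)
  rwa [hsum, ← add_div, div_le_one hP] at h

theorem elemSymm_eq_prod_div {ι : Type*} (s : Finset ι) {k : ℕ} {x : ι → ℝ}
    (hx : ∀ j ≤ k, 0 < elemSymm s j x) :
    elemSymm s k x = ∏ j ∈ range k, elemSymm s (j + 1) x / elemSymm s j x := by
  induction k with
  | zero => simp
  | succ k ih =>
    rw [Finset.prod_range_succ, ← ih fun j hj => hx j (by omega),
      mul_div_cancel₀ _ (hx k (by omega)).ne']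

/-- `S_k^{1/k}` is superadditive on `Γ_k`. -/
theorem elemSymm_rpow_superadditive {ι : Type*} [DecidableEq ι] (s : Finset ι) {k : ℕ}
    (hk : k ≠ 0) {x y : ι → ℝ}
    (hx : ∀ j ≤ k, 0 < elemSymm s j x) (hy : ∀ j ≤ k, 0 < elemSymm s j y) :
    elemSymm s k x ^ (1 / (k : ℝ)) + elemSymm s k y ^ (1 / (k : ℝ)) ≤
      elemSymm s k (x + y) ^ (1 / (k : ℝ)) := by
  have hxy := (elemSymm_div_superadditive k s hx hy).1
  have hpos : ∀ z : ι → ℝ, (∀ j ≤ k, 0 < elemSymm s j z) →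
      ∀ j < k, 0 < elemSymm s (j + 1) z / elemSymm s j z := fun z hz j hj =>
    div_pos (hz _ hj) (hz _ hj.le)
  rw [elemSymm_eq_prod_div s hx, elemSymm_eq_prod_div s hy, elemSymm_eq_prod_div s hxy]
  refine (geom_mean_superadditive hk (hpos x hx) (hpos y hy)).trans ?_
  refine Real.rpow_le_rpow (Finset.prod_nonneg fun j hj => ?_)
    (Finset.prod_le_prod (fun j hj => ?_) fun j hj => ?_) (by positivity)
  · exact (add_pos (hpos x hx j (mem_range.1 hj)) (hpos y hy j (mem_range.1 hj))).le
  · exact (add_pos (hpos x hx j (mem_range.1 hj)) (hpos y hy j (mem_range.1 hj))).le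
  · have hj' := mem_range.1 hj
    exact (elemSymm_div_superadditive j s (fun l hl => hx l (by omega))
      fun l hl => hy l (by omega)).2

theorem elemSymm_smul {ι : Type*} (s : Finset ι) (k : ℕ) (c : ℝ) (x : ι → ℝ) :
    elemSymm s k (c • x) = c ^ k * elemSymm s k x := by
  unfold elemSymm
  rw [Finset.mul_sum]
  refine Finset.sum_congr rfl fun t ht => ?_
  simp [Finset.prod_mul_distrib, (Finset.mem_powersetCard.1 ht).2]

/-- `S_k^{1/k}` is concave on the Gårding cone `Γ_k`. -/
theorem stmt7 (n k : ℕ) (hk1 : 1 ≤ k) (hkn : k ≤ n)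
    (lam mu : Fin n → ℝ) (hl : lam ∈ Gamma (Fin n) k) (hmu : mu ∈ Gamma (Fin n) k)
    (t : ℝ) (ht0 : 0 ≤ t) (ht1 : t ≤ 1) :
    t * (S k lam) ^ (1/(k:ℝ)) + (1-t) * (S k mu) ^ (1/(k:ℝ)) ≤
      (S k (fun i => t * lam i + (1-t) * mu i)) ^ (1/(k:ℝ)) := by
  have hk : k ≠ 0 := by omega
  have hpos : ∀ z ∈ Gamma (Fin n) k, ∀ j ≤ k, 0 < elemSymm univ j z := by
    intro z hz j hj
    rcases Nat.eq_zero_or_pos j with rfl | h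
    · simp
    · exact hz j h hj
  have hscale : ∀ z ∈ Gamma (Fin n) k, ∀ c : ℝ, 0 ≤ c →
      elemSymm univ k (c • z) ^ (1 / (k : ℝ)) = c * S k z ^ (1 / (k : ℝ)) := by
    intro z hz c hc
    rw [elemSymm_smul, Real.mul_rpow (by positivity) (hpos z hz k le_rfl).le, one_div,
      Real.pow_rpow_inv_natCast hc hk]
    rfl
  have hsmul : ∀ z ∈ Gamma (Fin n) k, ∀ c : ℝ, 0 < c →
      ∀ j ≤ k, 0 < elemSymm univ j (c • z) := by
    intro z hz c hc j hj
    rw [elemSymm_smul]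
    exact mul_pos (pow_pos hc j) (hpos z hz j hj)
  have ht1' : 0 ≤ 1 - t := sub_nonneg.2 ht1
  rw [← hscale lam hl t ht0, ← hscale mu hmu (1 - t) ht1']
  change _ ≤ elemSymm univ k (t • lam + (1 - t) • mu) ^ (1 / (k : ℝ))
  rcases ht0.eq_or_lt with rfl | ht0
  · rw [hscale lam hl 0 le_rfl]
    simp
  rcases ht1'.eq_or_lt with h | h
  · rw [← h, hscale mu hmu 0 le_rfl]
    simp
  exact elemSymm_rpow_superadditive univ hk (hsmul lam hl t ht0) (hsmul mu hmu _ h)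
end
end

section
/- Let λ ∈ Γ_k ⊆ ℝ^n with 1 ≤ k ≤ n. Then Σ_{i=1}^n ∂(S_k^{1/k})/∂λ_i ≥ (C_n^k)^{1/k}; equivalently, ((n−k+1)/k) S_{k−1}(λ) ≥ (C_n^k)^{1/k} S_k(λ)^{(k−1)/k}, where C_n^k = n!/(k!(n−k)!). -/
open Finset

noncomputable section

open Polynomial in
/-- Rolle's theorem in terms of elementary symmetric functions: the derivative of a real-rooted
monic polynomial of degree `n + 1` is real-rooted. -/
theorem exists_multiset_esymm_derivative (s : Multiset ℝ) (n : ℕ) (hs : s.card = n + 1) :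
    ∃ t : Multiset ℝ, t.card = n ∧
      ∀ i ≤ n, ((n : ℝ) + 1) * t.esymm i = ((n : ℝ) + 1 - i) * s.esymm i := by
  set P : ℝ[X] := (s.map fun r => X + C r).prod with hP
  have hPm : P.Monic := monic_multiset_prod_of_monic _ _ fun r _ => monic_X_add_C r
  have hPdeg : P.natDegree = n + 1 := by
    rw [hP, natDegree_multiset_prod_of_monic]
    · simp [hs, add_comm]
    · simp only [Multiset.mem_map]
      rintro _ ⟨r, _, rfl⟩
      exact monic_X_add_C r
  have hroots : P.roots.card = n + 1 := by
    have h : P = ((s.map Neg.neg).map fun r => X - C r).prod := by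
      rw [hP, Multiset.map_map]
      congr 1
      exact Multiset.map_congr rfl fun r _ => by simp
    rw [h, roots_multiset_prod_X_sub_C, Multiset.card_map, hs]
  have hdeg : P.derivative.natDegree = n := by
    rw [natDegree_derivative, hPdeg, Nat.add_sub_cancel]
  have hlead : P.derivative.leadingCoeff = (n : ℝ) + 1 := by
    rw [leadingCoeff, hdeg, coeff_derivative, ← hPdeg, hPm.coeff_natDegree, one_mul]
  have hcard : P.derivative.roots.card = n := by
    have h₁ := card_roots_le_derivative P
    have h₂ := card_roots' P.derivative
    omega
  have hfac : P.derivative =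
      C ((n : ℝ) + 1) * ((P.derivative.roots.map Neg.neg).map fun r => X + C r).prod := by
    rw [← hlead]
    conv_lhs => rw [← C_leadingCoeff_mul_prod_multiset_X_sub_C (hcard.trans hdeg.symm)]
    rw [Multiset.map_map]
    congr 2
    exact Multiset.map_congr rfl fun r _ => by simp [sub_eq_add_neg]
  refine ⟨P.derivative.roots.map Neg.neg, by rw [Multiset.card_map, hcard], fun i hi => ?_⟩
  have hc := congrArg (fun q => q.coeff (n - i)) hfac
  simp only [coeff_C_mul] at hc
  have hl : P.coeff (n - i + 1) = s.esymm i := by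
    rw [hP, Multiset.prod_X_add_C_coeff _ (by omega), hs,
      show n + 1 - (n - i + 1) = i by omega]
  have ht : (P.derivative.roots.map Neg.neg).card = n := by rw [Multiset.card_map, hcard]
  rw [coeff_derivative, hl, Multiset.prod_X_add_C_coeff _ (by omega), ht,
    show n - (n - i) = i by omega, Nat.cast_sub hi] at hc
  linarith

theorem esymm_cons_succ (a : ℝ) (s : Multiset ℝ) (k : ℕ) :
    (a ::ₘ s).esymm (k + 1) = s.esymm (k + 1) + a * s.esymm k := by
  simp [Multiset.esymm, Multiset.powersetCard_cons, Multiset.map_map, Multiset.sum_map_mul_left]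

theorem esymm_of_card_lt (s : Multiset ℝ) (k : ℕ) (h : s.card < k) : s.esymm k = 0 := by
  simp [Multiset.esymm, Multiset.powersetCard_eq_empty _ h]

/-- Newton's inequality for the three top elementary symmetric functions. -/
theorem newton_esymm_top (i : ℕ) (s : Multiset ℝ) (hs : s.card = i + 2) :
    2 * ((i : ℝ) + 2) * (s.esymm i * s.esymm (i + 2)) ≤ ((i : ℝ) + 1) * s.esymm (i + 1) ^ 2 := by
  induction i generalizing s with
  | zero =>
    obtain ⟨a, b, rfl⟩ := Multiset.card_eq_two.mp hs
    have h₁ : ({a, b} : Multiset ℝ).esymm 1 = a + b := by simp [Multiset.esymm_pair_one]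
    have h₂ : ({a, b} : Multiset ℝ).esymm 2 = a * b := by simp [Multiset.esymm_pair_two]
    have h₀ : ({a, b} : Multiset ℝ).esymm 0 = 1 := by simp [Multiset.esymm]
    simp only [zero_add, h₀, h₁, h₂, Nat.cast_zero]
    nlinarith [sq_nonneg (a - b)]
  | succ i ih =>
    obtain ⟨a, t, rfl⟩ : ∃ a t, s = a ::ₘ t := by
      obtain ⟨a, ha⟩ := Multiset.card_pos_iff_exists_mem.mp (by omega : 0 < s.card)
      exact ⟨a, Multiset.exists_cons_of_mem ha⟩
    have ht : t.card = i + 2 := by simpa using hs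
    have hD := ih t ht
    rw [show i + 1 + 2 = i + 2 + 1 by ring, esymm_cons_succ,
      esymm_cons_succ, esymm_cons_succ, esymm_of_card_lt t (i + 2 + 1) (by omega)]
    rw [show i + 1 + 1 = i + 2 by ring]
    push_cast
    set x := t.esymm i
    set y := t.esymm (i + 1)
    set z := t.esymm (i + 2)
    have hi : (0 : ℝ) < (i : ℝ) + 2 := by positivity
    have key : ((i : ℝ) + 2) * (((i : ℝ) + 1 + 1) * (z + a * y) ^ 2 -
        2 * ((i : ℝ) + 1 + 2) * ((y + a * x) * (0 + a * z))) =
        a ^ 2 * ((i : ℝ) + 3) * (((i : ℝ) + 1) * y ^ 2 - 2 * ((i : ℝ) + 2) * (x * z)) +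
          (a * y - ((i : ℝ) + 2) * z) ^ 2 := by ring
    have hnonneg : 0 ≤ ((i : ℝ) + 2) * (((i : ℝ) + 1 + 1) * (z + a * y) ^ 2 -
        2 * ((i : ℝ) + 1 + 2) * ((y + a * x) * (0 + a * z))) := by
      rw [key]
      have := sub_nonneg.mpr hD
      positivity
    exact sub_nonneg.mp (nonneg_of_mul_nonneg_right hnonneg hi)

/-- Newton's inequality for real families of any sign. -/
theorem newton_esymm (i d : ℕ) (s : Multiset ℝ) (hs : s.card = i + 2 + d) :
    ((i : ℝ) + 2) * ((d : ℝ) + 2) * (s.esymm i * s.esymm (i + 2)) ≤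
      ((i : ℝ) + 1) * ((d : ℝ) + 1) * s.esymm (i + 1) ^ 2 := by
  induction d generalizing s with
  | zero =>
    have := newton_esymm_top i s hs
    push_cast
    linarith
  | succ d ih =>
    obtain ⟨t, ht, hst⟩ := exists_multiset_esymm_derivative s (i + 2 + d) hs
    have h := ih t ht
    have h₀ := hst i (by omega)
    have h₁ := hst (i + 1) (by omega)
    have h₂ := hst (i + 2) (by omega)
    push_cast at h₀ h₁ h₂ ⊢
    set N : ℝ := (i : ℝ) + 2 + d + 1 with hN
    rw [show N - i = (d : ℝ) + 3 by rw [hN]; ring] at h₀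
    rw [show N - (i + 1) = (d : ℝ) + 2 by rw [hN]; ring] at h₁
    rw [show N - (i + 2) = (d : ℝ) + 1 by rw [hN]; ring] at h₂
    have h' := mul_le_mul_of_nonneg_left h (sq_nonneg N)
    have e₁ : N ^ 2 * (((i : ℝ) + 2) * ((d : ℝ) + 2) * (t.esymm i * t.esymm (i + 2))) =
        (((d : ℝ) + 1) * ((d : ℝ) + 2)) *
          (((i : ℝ) + 2) * ((d : ℝ) + 1 + 2) * (s.esymm i * s.esymm (i + 2))) := by
      calc _ = ((i : ℝ) + 2) * ((d : ℝ) + 2) * ((N * t.esymm i) * (N * t.esymm (i + 2))) := by ring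
        _ = _ := by rw [h₀, h₂]; ring
    have e₂ : N ^ 2 * (((i : ℝ) + 1) * ((d : ℝ) + 1) * t.esymm (i + 1) ^ 2) =
        (((d : ℝ) + 1) * ((d : ℝ) + 2)) *
          (((i : ℝ) + 1) * ((d : ℝ) + 1 + 1) * s.esymm (i + 1) ^ 2) := by
      calc _ = ((i : ℝ) + 1) * ((d : ℝ) + 1) * (N * t.esymm (i + 1)) ^ 2 := by ring
        _ = _ := by rw [h₁]; ring
    rw [e₁, e₂] at h'
    exact le_of_mul_le_mul_left h' (by positivity)

theorem S_eq_esymm {n : ℕ} (k : ℕ) (lam : Fin n → ℝ) :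
    S k lam = (Finset.univ.val.map lam).esymm k :=
  (Finset.esymm_map_val lam Finset.univ k).symm

theorem S_zero {n : ℕ} (lam : Fin n → ℝ) : S 0 lam = 1 := by simp [S]

theorem cast_choose_succ_mul (n i : ℕ) (h : i ≤ n) :
    (n.choose (i + 1) : ℝ) * ((i : ℝ) + 1) = n.choose i * ((n : ℝ) - i) := by
  have := Nat.choose_succ_right_eq n i
  rw [← Nat.cast_sub h]
  exact_mod_cast this

/-- Newton's inequality for the normalized elementary symmetric means. -/
theorem newton_mean {n : ℕ} (i : ℕ) (hi : i + 2 ≤ n) (lam : Fin n → ℝ) :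
    (S (i + 2) lam / n.choose (i + 2)) * (S i lam / n.choose i) ≤
      (S (i + 1) lam / n.choose (i + 1)) ^ 2 := by
  obtain ⟨d, rfl⟩ := Nat.exists_eq_add_of_le hi
  have hN := newton_esymm i d (Finset.univ.val.map lam) (by simp)
  simp only [← S_eq_esymm] at hN
  have c₁ := cast_choose_succ_mul (i + 2 + d) i (by omega)
  have c₂ := cast_choose_succ_mul (i + 2 + d) (i + 1) (by omega)
  have p₀ : (0 : ℝ) < (i + 2 + d).choose i := by exact_mod_cast Nat.choose_pos (by omega)
  have p₁ : (0 : ℝ) < (i + 2 + d).choose (i + 1) := by exact_mod_cast Nat.choose_pos (by omega)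
  have p₂ : (0 : ℝ) < (i + 2 + d).choose (i + 2) := by exact_mod_cast Nat.choose_pos (by omega)
  push_cast at c₁ c₂
  rw [show i + 1 + 1 = i + 2 by ring] at c₂
  set x := S i lam
  set y := S (i + 1) lam
  set z := S (i + 2) lam
  set a : ℝ := (((i + 2 + d).choose i : ℕ) : ℝ)
  set b : ℝ := (((i + 2 + d).choose (i + 1) : ℕ) : ℝ)
  set c : ℝ := (((i + 2 + d).choose (i + 2) : ℕ) : ℝ)
  have ha : a = b * ((i : ℝ) + 1) / ((d : ℝ) + 2) := by
    rw [eq_div_iff (by positivity)]; linarith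
  have hc : c = b * ((d : ℝ) + 1) / ((i : ℝ) + 2) := by
    rw [eq_div_iff (by positivity)]; linarith
  rw [div_mul_div_comm, div_pow, div_le_div_iff₀ (by positivity) (by positivity), ha, hc]
  have e : y ^ 2 * (b * ((d : ℝ) + 1) / ((i : ℝ) + 2) * (b * ((i : ℝ) + 1) / ((d : ℝ) + 2))) =
      b ^ 2 * (((i : ℝ) + 1) * ((d : ℝ) + 1) * y ^ 2) / (((i : ℝ) + 2) * ((d : ℝ) + 2)) := by
    field_simp
  rw [e, le_div_iff₀ (by positivity)]
  have := mul_le_mul_of_nonneg_left hN (sq_nonneg b)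
  linarith

/-- Maclaurin's inequality in the Gårding cone. -/
theorem maclaurin_mean {n : ℕ} (k : ℕ) (hkn : k + 1 ≤ n) (lam : Fin n → ℝ)
    (hG : lam ∈ Gamma (Fin n) (k + 1)) :
    (S (k + 1) lam / n.choose (k + 1)) ^ k ≤ (S k lam / n.choose k) ^ (k + 1) := by
  induction k with
  | zero => simp [S_zero]
  | succ k ih =>
    have hpos : ∀ j ≤ k + 2, 0 < S j lam / n.choose j := by
      intro j hj
      have hc : (0 : ℝ) < n.choose j := by exact_mod_cast Nat.choose_pos (by omega)
      refine div_pos ?_ hc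
      rcases Nat.eq_zero_or_pos j with rfl | h
      · simp [S_zero]
      · exact hG j h hj
    have hI := ih (by omega) fun j h₁ h₂ => hG j h₁ (by omega)
    have hN := newton_mean k hkn lam
    have h₀ := hpos k (by omega)
    have h₁ := hpos (k + 1) (by omega)
    have h₂ := hpos (k + 2) le_rfl
    rw [show k + 1 + 1 = k + 2 by ring]
    set x := S k lam / n.choose k
    set y := S (k + 1) lam / n.choose (k + 1)
    set z := S (k + 2) lam / n.choose (k + 2)
    refine le_of_mul_le_mul_right ?_ (pow_pos h₀ (k + 1))
    calc z ^ (k + 1) * x ^ (k + 1) = (z * x) ^ (k + 1) := (mul_pow _ _ _).symm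
      _ ≤ (y ^ 2) ^ (k + 1) := by gcongr
      _ = y ^ (k + 2) * y ^ k := by ring
      _ ≤ y ^ (k + 2) * x ^ (k + 1) := by gcongr

/-- `Σ_i ∂(S_k^{1/k})/∂λ_i ≥ (C_n^k)^{1/k}`, in the equivalent algebraic form
`((n-k+1)/k) S_{k-1}(λ) ≥ (C_n^k)^{1/k} S_k(λ)^{(k-1)/k}`. -/
theorem stmt9 (n k : ℕ) (hk1 : 1 ≤ k) (hkn : k ≤ n)
    (lam : Fin n → ℝ) (hG : lam ∈ Gamma (Fin n) k) :
    (n.choose k : ℝ) ^ (1/(k:ℝ)) * (S k lam) ^ (((k:ℝ)-1)/(k:ℝ)) ≤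
      (((n:ℝ) - k + 1)/(k:ℝ)) * S (k-1) lam := by
  obtain ⟨m, rfl⟩ := Nat.exists_eq_add_of_le' hk1
  have hM := maclaurin_mean m hkn lam hG
  have hc : (0 : ℝ) < n.choose (m + 1) := by exact_mod_cast Nat.choose_pos hkn
  have hc' : (0 : ℝ) < n.choose m := by exact_mod_cast Nat.choose_pos (by omega)
  have hS : 0 < S (m + 1) lam := hG _ hk1 le_rfl
  have hS' : 0 < S m lam := by
    rcases Nat.eq_zero_or_pos m with rfl | h
    · simp [S_zero]
    · exact hG m h (by omega)
  have hcc := cast_choose_succ_mul n m (by omega)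
  rw [Nat.add_sub_cancel]
  push_cast
  have hm : (0 : ℝ) < (m : ℝ) + 1 := by positivity
  have hR : ((n : ℝ) - (m + 1) + 1) / ((m : ℝ) + 1) * S m lam =
      n.choose (m + 1) * (S m lam / n.choose m) := by
    field_simp
    linear_combination -hcc
  rw [hR]
  refine le_of_pow_le_pow_left₀ m.succ_ne_zero (by positivity) ?_
  have e₁ : ((n.choose (m + 1) : ℝ) ^ (1 / ((m : ℝ) + 1))) ^ (m + 1) = n.choose (m + 1) := by
    rw [← Real.rpow_natCast, ← Real.rpow_mul hc.le]
    push_cast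
    rw [one_div_mul_cancel hm.ne', Real.rpow_one]
  have e₂ : (S (m + 1) lam ^ (((m : ℝ) + 1 - 1) / ((m : ℝ) + 1))) ^ (m + 1) =
      S (m + 1) lam ^ m := by
    rw [← Real.rpow_natCast, ← Real.rpow_mul hS.le]
    push_cast
    rw [div_mul_cancel₀ _ hm.ne', add_sub_cancel_right, Real.rpow_natCast]
  rw [Nat.succ_eq_add_one, mul_pow, mul_pow, e₁, e₂]
  calc (n.choose (m + 1) : ℝ) * S (m + 1) lam ^ m
      = (n.choose (m + 1) : ℝ) ^ (m + 1) * (S (m + 1) lam / n.choose (m + 1)) ^ m := by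
        rw [div_pow]; field_simp; ring
    _ ≤ _ := by gcongr
end
end

section
/- Let 2 ≤ m ≤ n−1 and 2 ≤ k ≤ ((n−m)/n)·C_n^m. Let μ = (μ_1, …, μ_n) with μ_1 ≥ ⋯ ≥ μ_n, and let λ ∈ ℝ^{C_n^m} be the vector of all m-fold sums μ_{i_1} + ⋯ + μ_{i_m} over 1 ≤ i_1 < ⋯ < i_m ≤ n. Suppose μ ∈ Γ_k^{(m)}, μ_n < −δL < 0 for constants δ > 0 and L > 0, and in addition −δ_1 L ≤ λ_i ≤ mL for all 1 ≤ i ≤ C_n^m, where δ_1 = δ^k/((C_n^m)!·4^k). Then, with θ_2 = δ^{k−1}/(2^k m^{k−1} (C_n^m)^3), one has S_{k−1}(λ|i) ≥ θ_2 Σ_{j=1}^{C_n^m} S_{k−1}(λ|j) for every 1 ≤ i ≤ C_n^m. -/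
open Finset

noncomputable section

/-- The `k`-th elementary symmetric function of the entries of `w` indexed by `F`. -/
def esymmOn {ι : Type*} (k : ℕ) (F : Finset ι) (w : ι → ℝ) : ℝ :=
  ∑ s ∈ F.powersetCard k, ∏ i ∈ s, w i

theorem S_update_zero {ι : Type*} [Fintype ι] [DecidableEq ι] (k : ℕ) (w : ι → ℝ) (i : ι) :
    S k (Function.update w i 0) = esymmOn k (univ.erase i) w := by
  unfold S esymmOn
  rw [← Finset.sum_subset (powersetCard_mono (erase_subset i univ))]
  · refine sum_congr rfl fun s hs => prod_congr rfl fun j hj => ?_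
    have := (mem_powersetCard.1 hs).1 hj
    rw [Function.update_of_ne (ne_of_mem_erase this)]
  · intro s hs hs'
    have hi : i ∈ s := by
      by_contra hi
      exact hs' (mem_powersetCard.2 ⟨subset_erase.2 ⟨subset_univ s, hi⟩, (mem_powersetCard.1 hs).2⟩)
    exact prod_eq_zero hi (by simp)

theorem esymmOn_succ_univ {ι : Type*} [Fintype ι] [DecidableEq ι] (k : ℕ) (w : ι → ℝ) (i : ι) :
    esymmOn (k + 1) univ w =
      esymmOn (k + 1) (univ.erase i) w + w i * esymmOn k (univ.erase i) w := by
  unfold esymmOn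
  have hni : i ∉ univ.erase i := notMem_erase i univ
  have hsub : ∀ {l : ℕ} {s : Finset ι}, s ∈ (univ.erase i).powersetCard l → i ∉ s :=
    fun hs h => hni ((mem_powersetCard.1 hs).1 h)
  conv_lhs => rw [← insert_erase (mem_univ i), powersetCard_succ_insert hni]
  rw [sum_union, sum_image, mul_sum]
  · congr 1
    exact sum_congr rfl fun s hs => prod_insert (hsub hs)
  · intro s hs t ht h
    rw [← erase_insert (hsub hs), ← erase_insert (hsub ht)]
    exact congrArg (fun u => erase u i) h
  · rw [disjoint_right]
    intro s hs h
    obtain ⟨t, -, rfl⟩ := mem_image.1 hs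
    exact hsub h (mem_insert_self i t)

theorem esymmOn_mono {ι : Type*} {k : ℕ} {F G : Finset ι} (hFG : F ⊆ G) {w : ι → ℝ}
    (hw : ∀ i, 0 ≤ w i) : esymmOn k F w ≤ esymmOn k G w :=
  sum_le_sum_of_subset_of_nonneg (powersetCard_mono hFG)
    fun _ _ _ => prod_nonneg fun j _ => hw j

/-- Double counting of pairs consisting of a `(k+1)`-set and one of its elements. -/
theorem succ_mul_esymmOn {ι : Type*} [DecidableEq ι] (k : ℕ) (F : Finset ι) (w : ι → ℝ) :
    (k + 1 : ℝ) * esymmOn (k + 1) F w =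
      ∑ s ∈ F.powersetCard k, ∑ b ∈ F \ s, w b * ∏ i ∈ s, w i := by
  have h : (k + 1 : ℝ) * esymmOn (k + 1) F w =
      ∑ t ∈ F.powersetCard (k + 1), ∑ b ∈ t, w b * ∏ i ∈ t.erase b, w i := by
    unfold esymmOn
    rw [mul_sum]
    refine sum_congr rfl fun t ht => ?_
    rw [sum_congr rfl fun b hb => mul_prod_erase t w hb, sum_const, (mem_powersetCard.1 ht).2]
    simp
  rw [h, sum_sigma', sum_sigma']
  refine sum_bij' (fun x _ => ⟨x.1.erase x.2, x.2⟩) (fun x _ => ⟨insert x.2 x.1, x.2⟩) ?_ ?_ ?_ ?_ ?_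
  · rintro ⟨t, b⟩ hx
    obtain ⟨ht, hb⟩ := mem_sigma.1 hx
    obtain ⟨htF, htc⟩ := mem_powersetCard.1 ht
    simp only [mem_sigma, mem_powersetCard, mem_sdiff]
    refine ⟨⟨(erase_subset _ _).trans htF, ?_⟩, htF hb, notMem_erase _ _⟩
    rw [card_erase_of_mem hb, htc, Nat.add_sub_cancel]
  · rintro ⟨s, b⟩ hx
    obtain ⟨hs, hb⟩ := mem_sigma.1 hx
    obtain ⟨hsF, hsc⟩ := mem_powersetCard.1 hs
    obtain ⟨hbF, hbs⟩ := mem_sdiff.1 hb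
    simp only [mem_sigma, mem_powersetCard]
    exact ⟨⟨insert_subset hbF hsF, by rw [card_insert_of_notMem hbs, hsc]⟩, mem_insert_self _ _⟩
  · rintro ⟨t, b⟩ hx
    simp [insert_erase (mem_sigma.1 hx).2]
  · rintro ⟨s, b⟩ hx
    simp [erase_insert (mem_sdiff.1 (mem_sigma.1 hx).2).2]
  · rintro ⟨t, b⟩ hx
    rfl

theorem mul_esymmOn_le_succ_mul_esymmOn {ι : Type*} [DecidableEq ι] {k : ℕ} {B F : Finset ι}
    (hBF : B ⊆ F) (hB : k + 1 ≤ #B) {w : ι → ℝ} (hw : ∀ i, 0 ≤ w i) {β : ℝ}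
    (hβ : ∀ i ∈ B, β ≤ w i) :
    β * esymmOn k F w ≤ (k + 1 : ℝ) * esymmOn (k + 1) F w := by
  rw [succ_mul_esymmOn, esymmOn, mul_sum]
  refine sum_le_sum fun s hs => ?_
  have hprod : ∀ t : Finset ι, 0 ≤ ∏ i ∈ t, w i := fun t => prod_nonneg fun j _ => hw j
  obtain ⟨b, hb, hbs⟩ := exists_mem_notMem_of_card_lt_card
    (show #s < #B by rw [(mem_powersetCard.1 hs).2]; omega)
  calc β * ∏ i ∈ s, w i ≤ w b * ∏ i ∈ s, w i := mul_le_mul_of_nonneg_right (hβ b hb) (hprod s)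
    _ ≤ _ := single_le_sum (f := fun b => w b * ∏ i ∈ s, w i)
        (fun j _ => mul_nonneg (hw j) (hprod s)) (mem_sdiff.2 ⟨hBF hb, hbs⟩)

theorem pow_le_esymmOn {ι : Type*} {k : ℕ} {B F : Finset ι}
    (hBF : B ⊆ F) (hB : k ≤ #B) {w : ι → ℝ} (hw : ∀ i, 0 ≤ w i) {β : ℝ} (hβ0 : 0 ≤ β)
    (hβ : ∀ i ∈ B, β ≤ w i) : β ^ k ≤ esymmOn k F w := by
  obtain ⟨s, hsB, hsc⟩ := exists_subset_card_eq hB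
  calc β ^ k = ∏ _i ∈ s, β := by rw [prod_const, hsc]
    _ ≤ ∏ i ∈ s, w i := prod_le_prod (fun _ _ => hβ0) fun i hi => hβ i (hsB hi)
    _ ≤ _ := single_le_sum (f := fun s => ∏ i ∈ s, w i)
        (fun t _ => prod_nonneg fun j _ => hw j) (mem_powersetCard.2 ⟨hsB.trans hBF, hsc⟩)

theorem abs_esymmOn_sub_posPart_le {ι : Type*} [DecidableEq ι] (k : ℕ) (F : Finset ι) {w : ι → ℝ}
    {ε M : ℝ} (hε : 0 ≤ ε) (hεM : ε ≤ M) (hlow : ∀ i, -ε ≤ w i) (hupp : ∀ i, w i ≤ M) :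
    |esymmOn (k + 1) F w - esymmOn (k + 1) F (fun i => max (w i) 0)| ≤
      ((#F).choose (k + 1) : ℝ) * (ε * M ^ k) := by
  have hM : 0 ≤ M := hε.trans hεM
  unfold esymmOn
  rw [← sum_sub_distrib]
  refine (abs_sum_le_sum_abs _ _).trans ?_
  rw [← card_powersetCard, ← nsmul_eq_mul]
  refine sum_le_card_nsmul _ _ _ fun s hs => ?_
  by_cases h : ∃ j ∈ s, w j < 0
  · obtain ⟨j, hj, hneg⟩ := h
    rw [prod_eq_zero (f := fun i => max (w i) 0) hj (max_eq_right hneg.le), sub_zero,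
      ← mul_prod_erase s w hj, abs_mul, abs_prod]
    have hcard : #(s.erase j) = k := by
      rw [card_erase_of_mem hj, (mem_powersetCard.1 hs).2, Nat.add_sub_cancel]
    refine mul_le_mul (abs_le.2 ⟨hlow j, by linarith⟩) ?_ (prod_nonneg fun _ _ => abs_nonneg _) hε
    calc ∏ i ∈ s.erase j, |w i| ≤ ∏ _i ∈ s.erase j, M :=
          prod_le_prod (fun _ _ => abs_nonneg _)
            fun i _ => abs_le.2 ⟨by linarith [hlow i], hupp i⟩
      _ = M ^ k := by rw [prod_const, hcard]
  · push Not at h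
    rw [prod_congr rfl fun i hi => (max_eq_left (h i hi)).symm, sub_self, abs_zero]
    positivity

/-- If at least `k + 1` entries of `w` other than `w i` are `≥ β`, all entries are at most `M` and
the negative ones are tiny, then `S_{k+1}(w|i)` controls `S_{k+1}(w|j)`. -/
theorem esymmOn_erase_le {ι : Type*} [Fintype ι] [DecidableEq ι] {k : ℕ} {w : ι → ℝ}
    {ε M β : ℝ} (hε : 0 ≤ ε) (hεM : ε ≤ M) (hβ0 : 0 < β)
    (hlow : ∀ i, -ε ≤ w i) (hupp : ∀ i, w i ≤ M) {B : Finset ι} (hβ : ∀ i ∈ B, β ≤ w i)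
    (hB : k + 2 ≤ #B)
    (hsmall : 2 * (((Fintype.card ι - 1).choose (k + 1) : ℝ) * (ε * M ^ k)) ≤ β ^ (k + 1))
    (i j : ι) :
    β * esymmOn (k + 1) (univ.erase j) w ≤
      (3 * β + 2 * (k + 1) * M) * esymmOn (k + 1) (univ.erase i) w := by
  have hM : 0 ≤ M := hε.trans hεM
  have hcard : ∀ l : ι, #(univ.erase l) = Fintype.card ι - 1 := fun l => by
    rw [card_erase_of_mem (mem_univ l), card_univ]
  have hi := abs_le.1 (abs_esymmOn_sub_posPart_le k (univ.erase i) hε hεM hlow hupp)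
  have hj := abs_le.1 (abs_esymmOn_sub_posPart_le k (univ.erase j) hε hεM hlow hupp)
  rw [hcard] at hi hj
  set err := ((Fintype.card ι - 1).choose (k + 1) : ℝ) * (ε * M ^ k)
  set v : ι → ℝ := fun i => max (w i) 0
  have hv : ∀ l, 0 ≤ v l := fun l => le_max_right _ _
  have hβv : ∀ l ∈ B.erase i, β ≤ v l := fun l hl =>
    (hβ l (mem_of_mem_erase hl)).trans (le_max_left _ _)
  have hBi : k + 1 ≤ #(B.erase i) := by
    have := pred_card_le_card_erase (s := B) (a := i)
    omega
  have hsub : B.erase i ⊆ univ.erase i := erase_subset_erase i (subset_univ B)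
  have h1 := mul_esymmOn_le_succ_mul_esymmOn hsub hBi hv hβv
  have h2 := pow_le_esymmOn hsub hBi hv hβ0.le hβv
  have h3 := esymmOn_succ_univ k v i
  have h4 : esymmOn (k + 1) (univ.erase j) v ≤ esymmOn (k + 1) univ v :=
    esymmOn_mono (erase_subset _ _) hv
  have hQ : 0 ≤ esymmOn k (univ.erase i) v := sum_nonneg fun s _ => prod_nonneg fun l _ => hv l
  have hvM : v i ≤ M := max_le (hupp i) hM
  have hkey : β * esymmOn (k + 1) univ v ≤ (β + (k + 1) * M) * esymmOn (k + 1) (univ.erase i) v := by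
    rw [h3]
    have := mul_le_mul_of_nonneg_right hvM hQ
    have h5 := mul_le_mul_of_nonneg_left this hβ0.le
    have h6 := mul_le_mul_of_nonneg_left h1 hM
    linarith
  have hP : esymmOn (k + 1) (univ.erase i) v ≤ 2 * esymmOn (k + 1) (univ.erase i) w := by linarith
  have herr : err ≤ esymmOn (k + 1) (univ.erase i) w := by linarith
  calc β * esymmOn (k + 1) (univ.erase j) w
      ≤ β * (esymmOn (k + 1) univ v + err) := by gcongr; linarith
    _ ≤ (β + (k + 1) * M) * (2 * esymmOn (k + 1) (univ.erase i) w)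
        + β * esymmOn (k + 1) (univ.erase i) w := by
        rw [mul_add]
        exact add_le_add (hkey.trans (mul_le_mul_of_nonneg_left hP (by positivity)))
          (mul_le_mul_of_nonneg_left herr hβ0.le)
    _ = _ := by ring

/-- Double counting of pairs consisting of an `m`-subset of `A` and one of its elements. -/
theorem sum_powersetCard_sum {ι : Type*} [DecidableEq ι] {m : ℕ} (hm : m ≠ 0) (A : Finset ι)
    (f : ι → ℝ) :
    ∑ s ∈ A.powersetCard m, ∑ i ∈ s, f i = ((#A - 1).choose (m - 1) : ℝ) * ∑ i ∈ A, f i := by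
  obtain ⟨m, rfl⟩ := Nat.exists_eq_succ_of_ne_zero hm
  have : ∑ s ∈ A.powersetCard (m + 1), ∑ i ∈ s, f i =
      ∑ i ∈ A, ∑ _s ∈ (A.erase i).powersetCard m, f i := by
    rw [sum_sigma', sum_sigma']
    refine sum_bij' (fun x _ => ⟨x.2, x.1.erase x.2⟩) (fun x _ => ⟨insert x.1 x.2, x.1⟩)
      ?_ ?_ ?_ ?_ ?_
    · rintro ⟨t, b⟩ hx
      obtain ⟨ht, hb⟩ := mem_sigma.1 hx
      obtain ⟨htF, htc⟩ := mem_powersetCard.1 ht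
      simp only [mem_sigma, mem_powersetCard]
      refine ⟨htF hb, erase_subset_erase _ htF, ?_⟩
      rw [card_erase_of_mem hb, htc, Nat.add_sub_cancel]
    · rintro ⟨b, s⟩ hx
      obtain ⟨hb, hs⟩ := mem_sigma.1 hx
      obtain ⟨hsF, hsc⟩ := mem_powersetCard.1 hs
      obtain ⟨hsA, hbs⟩ := subset_erase.1 hsF
      simp only [mem_sigma, mem_powersetCard]
      exact ⟨⟨insert_subset hb hsA, by rw [card_insert_of_notMem hbs, hsc]⟩, mem_insert_self _ _⟩
    · rintro ⟨t, b⟩ hx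
      simp [insert_erase (mem_sigma.1 hx).2]
    · rintro ⟨b, s⟩ hx
      simp [erase_insert (subset_erase.1 (mem_powersetCard.1 (mem_sigma.1 hx).2).1).2]
    · rintro ⟨t, b⟩ hx
      rfl
  rw [this, mul_sum]
  refine sum_congr rfl fun i hi => ?_
  rw [sum_const, card_powersetCard, card_erase_of_mem hi, nsmul_eq_mul, Nat.succ_sub_one]

theorem choose_le_two_pow_mul_factorial {N k : ℕ} (hk : 1 ≤ k) (hkN : k ≤ N) :
    (N - 1).choose (k - 1) ≤ 2 ^ k * (N - k).factorial := by
  have h2 : ∀ a : ℕ, 2 ^ a ≤ 2 * a.factorial := fun a => by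
    rcases a with _ | a
    · simp
    · rw [pow_succ, mul_comm]
      exact Nat.mul_le_mul_left 2 (by simpa [add_comm] using Nat.factorial_mul_pow_le_factorial (m := 1) (n := a))
  calc (N - 1).choose (k - 1) ≤ 2 ^ (N - 1) := Nat.choose_le_two_pow _ _
    _ = 2 ^ (k - 1) * 2 ^ (N - k) := by rw [← pow_add]; congr 1; omega
    _ ≤ 2 ^ (k - 1) * (2 * (N - k).factorial) := by gcongr; exact h2 _
    _ = 2 ^ k * (N - k).factorial := by
        rw [← mul_assoc, ← pow_succ, Nat.sub_add_cancel hk]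

theorem pow_mul_factorial_le {N k t : ℕ} (hk : 1 ≤ k) (hkN : k + t ≤ N) :
    t ^ (k - 1) * (N - k).factorial ≤ (N - 1).factorial := by
  calc t ^ (k - 1) * (N - k).factorial ≤ (N - k + 1) ^ (k - 1) * (N - k).factorial := by
        gcongr; omega
    _ = (N - k).factorial * (N - k + 1) ^ (k - 1) := mul_comm _ _
    _ ≤ (N - k + (k - 1)).factorial := Nat.factorial_mul_pow_le_factorial
    _ = _ := by congr 1; omega

theorem le_choose_of_pos_of_lt {a b : ℕ} (hb : 0 < b) (hba : b < a) : a ≤ a.choose b := by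
  induction a generalizing b with
  | zero => omega
  | succ a ih =>
    obtain ⟨b, rfl⟩ := Nat.exists_eq_succ_of_ne_zero hb.ne'
    rw [Nat.succ_eq_add_one] at hb hba ⊢
    rw [Nat.choose_succ_succ']
    have h1 : 0 < a.choose b := Nat.choose_pos (by omega)
    rcases Nat.lt_or_ge (b + 1) a with h | h
    · have := ih hb h
      omega
    · obtain rfl : a = b + 1 := by omega
      simp

theorem S_one {ι : Type*} [Fintype ι] (w : ι → ℝ) : S 1 w = ∑ i, w i := by
  simp [S, powersetCard_one]

theorem sum_sumVec {n m : ℕ} (hm : m ≠ 0) (μ : Fin n → ℝ) :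
    ∑ s : MIdx n m, sumVec n m μ s = ((n - 1).choose (m - 1) : ℝ) * ∑ i, μ i := by
  have h := sum_powersetCard_sum hm (univ : Finset (Fin n)) μ
  rw [card_univ, Fintype.card_fin] at h
  rw [← h]
  exact (sum_subtype (univ.powersetCard m) (fun s => mem_powersetCard_univ)
    fun s => ∑ i ∈ s, μ i).symm

/-- If the total of `μ` is positive and all `m`-fold sums are at most `m * L`, then no entry is
below `-(n - 1) * L`. -/
theorem neg_le_of_sumVec_le {n m : ℕ} (hm : m ≠ 0) (hmn : m ≤ n - 1) {μ : Fin n → ℝ} {L : ℝ}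
    (hsum : 0 < ∑ i, μ i) (hupp : ∀ s : MIdx n m, sumVec n m μ s ≤ (m : ℝ) * L) (a : Fin n) :
    -μ a ≤ (n - 1 : ℕ) * L := by
  obtain ⟨q, hq⟩ : ∃ q, n - 1 = q + 1 := ⟨n - 2, by omega⟩
  obtain ⟨p, rfl⟩ := Nat.exists_eq_succ_of_ne_zero hm
  have hA : #(univ.erase a) = q + 1 := by
    rw [card_erase_of_mem (mem_univ a), card_univ, Fintype.card_fin, hq]
  have h := sum_powersetCard_sum hm (univ.erase a) μ
  have hle : ∑ s ∈ (univ.erase a).powersetCard (p + 1), ∑ i ∈ s, μ i ≤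
      ((q + 1).choose (p + 1) : ℝ) * ((p + 1 : ℕ) * L) := by
    rw [← hA, ← card_powersetCard, ← nsmul_eq_mul]
    exact sum_le_card_nsmul _ _ _ fun s hs => hupp ⟨s, (mem_powersetCard.1 hs).2⟩
  rw [Nat.succ_eq_add_one] at h
  rw [h, hA, Nat.add_sub_cancel, Nat.add_sub_cancel, ← mul_assoc] at hle
  have hch : ((q + 1).choose (p + 1) : ℝ) * (p + 1 : ℕ) = (q.choose p : ℝ) * (q + 1 : ℕ) := by
    rw [mul_comm (q.choose p : ℝ)]
    exact_mod_cast (Nat.add_one_mul_choose_eq q p).symm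
  rw [hch, mul_assoc] at hle
  have hpos : (0 : ℝ) < q.choose p := by
    exact_mod_cast Nat.choose_pos (by omega)
  have := le_of_mul_le_mul_left hle hpos
  have hsplit := add_sum_erase univ μ (mem_univ a)
  rw [hq]
  linarith

/-- An `m`-fold sum avoiding a very negative entry is large, because exchanging any of its
summands for that entry leaves the sum almost nonnegative. -/
theorem le_sumVec_of_notMem {n m : ℕ} (hm : 2 ≤ m) {μ : Fin n → ℝ} {c ε : ℝ} {a : Fin n}
    (ha : μ a ≤ -c) (hlow : ∀ s : MIdx n m, -ε ≤ sumVec n m μ s) (hε : m * ε ≤ c)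
    {s : MIdx n m} (has : a ∉ s.1) : c ≤ sumVec n m μ s := by
  have hi : ∀ i ∈ s.1, c - ε ≤ sumVec n m μ s - μ i := fun i hi => by
    have ha' : a ∉ s.1.erase i := fun h => has (mem_of_mem_erase h)
    have hc : #(insert a (s.1.erase i)) = m := by
      rw [card_insert_of_notMem ha', card_erase_of_mem hi, s.2]
      omega
    have h1 := hlow ⟨_, hc⟩
    have h2 := add_sum_erase s.1 μ hi
    simp only [sumVec] at h1 ⊢
    rw [sum_insert ha'] at h1
    linarith
  have h := card_nsmul_le_sum _ _ _ hi
  rw [sum_sub_distrib, sum_const, s.2, nsmul_eq_mul, nsmul_eq_mul] at h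
  change (m : ℝ) * (c - ε) ≤ m * sumVec n m μ s - sumVec n m μ s at h
  have hm' : (2 : ℝ) ≤ m := by exact_mod_cast hm
  refine le_of_mul_le_mul_left (a := (m : ℝ) - 1) ?_ (by linarith)
  linarith

theorem card_filter_notMem {n m : ℕ} (a : Fin n) :
    #{s : MIdx n m | a ∉ s.1} = (n - 1).choose m := by
  have : #((univ.erase a).powersetCard m) = (n - 1).choose m := by
    rw [card_powersetCard, card_erase_of_mem (mem_univ a), card_univ, Fintype.card_fin]
  rw [← this]
  refine card_bij' (fun s _ => s.1)
    (fun s hs => ⟨s, (mem_powersetCard.1 hs).2⟩) ?_ ?_ ?_ ?_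
  · intro s hs
    exact mem_powersetCard.2 ⟨subset_erase.2 ⟨subset_univ _, (mem_filter.1 hs).2⟩, s.2⟩
  · intro s hs
    exact mem_filter.2 ⟨mem_univ _, (subset_erase.1 (mem_powersetCard.1 hs).1).2⟩
  · intro s hs
    rfl
  · intro s hs
    rfl

theorem le_choose_pred_of_cast_le {n m k : ℕ} (hmn : m ≤ n - 1) (hn : 0 < n)
    (hk : (k : ℝ) ≤ (((n : ℝ) - m) / n) * (n.choose m : ℝ)) : k ≤ (n - 1).choose m := by
  obtain ⟨q, rfl⟩ := Nat.exists_eq_succ_of_ne_zero hn.ne'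
  rw [Nat.succ_eq_add_one] at hk hmn ⊢
  rw [Nat.add_sub_cancel] at hmn ⊢
  have h := Nat.choose_mul_succ_eq q m
  have hR : (q.choose m : ℝ) * (q + 1 : ℕ) = (q + 1).choose m * ((q + 1 : ℕ) - (m : ℝ)) := by
    rw [← Nat.cast_sub (by omega)]
    exact_mod_cast h
  have hq : (0 : ℝ) < (q + 1 : ℕ) := by positivity
  rw [div_mul_eq_mul_div, le_div_iff₀ hq, mul_comm (_ - _), ← hR] at hk
  exact_mod_cast le_of_mul_le_mul_right hk hq

/-- Under the additional two-sided bound `-δ_1 L ≤ λ_i ≤ mL`, each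
`∂S_k(λ)/∂λ_i` controls the full sum: `S_{k-1}(λ|i) ≥ θ_2 Σ_j S_{k-1}(λ|j)`. -/
theorem stmt13 (n m k : ℕ) (hm2 : 2 ≤ m) (hm : m ≤ n - 1) (hk2 : 2 ≤ k)
    (hk : (k : ℝ) ≤ (((n:ℝ) - m)/(n:ℝ)) * (n.choose m : ℝ))
    (μ : Fin n → ℝ) (hmono : ∀ i j : Fin n, i ≤ j → μ j ≤ μ i)
    (hG : μ ∈ GammaGen n m k)
    (δ L : ℝ) (hδ : 0 < δ) (hL : 0 < L)
    (hμn : μ ⟨n-1, by omega⟩ < -(δ*L))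
    (hlow : ∀ i : MIdx n m, -(δ^k / (((n.choose m).factorial : ℝ) * 4^k)) * L ≤ sumVec n m μ i)
    (hupp : ∀ i : MIdx n m, sumVec n m μ i ≤ (m:ℝ) * L) :
    ∀ i : MIdx n m,
      (δ^(k-1) / (2^k * (m:ℝ)^(k-1) * ((n.choose m : ℝ))^3)) *
        ∑ j : MIdx n m, S (k-1) (Function.update (sumVec n m μ) j 0) ≤
      S (k-1) (Function.update (sumVec n m μ) i 0) := by
  obtain ⟨K, rfl⟩ : ∃ K, k = K + 2 := ⟨k - 2, by omega⟩
  set a : Fin n := ⟨n - 1, by omega⟩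
  set N := n.choose m
  set D := δ ^ (K + 2) / ((N.factorial : ℝ) * 4 ^ (K + 2))
  have hkB : K + 2 ≤ (n - 1).choose m := le_choose_pred_of_cast_le hm (by omega) hk
  have hkN : K + 2 + (n - 1) ≤ N := by
    have h1 : n - 1 ≤ (n - 1).choose (m - 1) := le_choose_of_pos_of_lt (by omega) (by omega)
    have h2 := Nat.choose_eq_choose_pred_add (n := n) (k := m) (by omega) (by omega)
    omega
  have hfac : N * (N - 1).factorial = N.factorial := Nat.mul_factorial_pred (by omega)
  have hpow := pow_mul_factorial_le (by omega) hkN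
  have hfpos := Nat.factorial_pos (N - (K + 2))
  have hchoose := choose_le_two_pow_mul_factorial (N := N) (k := K + 2) (by omega) (by omega)
  rw [show K + 2 - 1 = K + 1 by omega] at hpow hchoose ⊢
  have hmt : m * (n - 1) ^ (K + 1) ≤ N.factorial := by
    rw [← hfac]
    exact Nat.mul_le_mul (by omega) ((Nat.le_mul_of_pos_right _ hfpos).trans hpow)
  have hCt : 2 * ((N - 1).choose (K + 1) * (n - 1) ^ (K + 1)) ≤
      N.factorial * 4 ^ (K + 2) := by
    calc 2 * ((N - 1).choose (K + 1) * (n - 1) ^ (K + 1))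
        ≤ 2 * (2 ^ (K + 2) * (N - (K + 2)).factorial * (n - 1) ^ (K + 1)) := by gcongr
      _ = 2 * 2 ^ (K + 2) * ((n - 1) ^ (K + 1) * (N - (K + 2)).factorial) := by ring
      _ ≤ (2 ^ (K + 2) * 2 ^ (K + 2)) * (N * (N - 1).factorial) := by
          exact Nat.mul_le_mul (Nat.mul_le_mul_right _ (Nat.le_self_pow (by omega) 2))
            (hpow.trans (Nat.le_mul_of_pos_left _ (by omega)))
      _ = N.factorial * 4 ^ (K + 2) := by
          rw [hfac, ← mul_pow, mul_comm]; norm_num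
  have hm2R : (2 : ℝ) ≤ m := by exact_mod_cast hm2
  have hmtR : (m : ℝ) ≤ (n - 1 : ℕ) := by exact_mod_cast hm
  have hNpos : (0 : ℝ) < N := by exact_mod_cast (by omega : 0 < N)
  have hden : (0 : ℝ) < (N.factorial : ℝ) * 4 ^ (K + 2) := by positivity
  have hD0 : 0 ≤ D := by positivity
  have hDmul : D * ((N.factorial : ℝ) * 4 ^ (K + 2)) = δ ^ (K + 2) := div_mul_cancel₀ _ hden.ne'
  have hδt : δ ≤ (n - 1 : ℕ) := by
    have h1 := hG 1 le_rfl (by omega)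
    rw [S_one, sum_sumVec (by omega)] at h1
    have h2 := neg_le_of_sumVec_le (by omega) hm (pos_of_mul_pos_right h1 (by positivity)) hupp a
    exact le_of_mul_le_mul_right (by linarith) hL
  have hmD : m * D ≤ δ := by
    refine le_of_mul_le_mul_right ?_ hden
    calc m * D * ((N.factorial : ℝ) * 4 ^ (K + 2)) = δ * (m * δ ^ (K + 1)) := by
          rw [mul_assoc, hDmul]; ring
      _ ≤ δ * (m * ((n - 1 : ℕ) : ℝ) ^ (K + 1)) := by gcongr
      _ ≤ δ * (N.factorial : ℝ) := by
          gcongr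
          exact_mod_cast hmt
      _ ≤ δ * ((N.factorial : ℝ) * 4 ^ (K + 2)) := by
          gcongr
          exact le_mul_of_one_le_right (by positivity) (one_le_pow₀ (by norm_num))
  have hlow' : ∀ s : MIdx n m, -(D * L) ≤ sumVec n m μ s := fun s => by
    rw [← neg_mul]; exact hlow s
  have hbig : ∀ s ∈ ({s : MIdx n m | a ∉ s.1} : Finset _), δ * L ≤ sumVec n m μ s := fun s hs =>
    le_sumVec_of_notMem hm2 hμn.le hlow'
      (by rw [← mul_assoc]; exact mul_le_mul_of_nonneg_right hmD hL.le) (mem_filter.1 hs).2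
  have hBcard := card_filter_notMem (m := m) a
  have hδm : δ ≤ m := by
    obtain ⟨s, hs⟩ := card_pos.1 (by omega : 0 < #({s : MIdx n m | a ∉ s.1} : Finset _))
    exact le_of_mul_le_mul_right ((hbig s hs).trans (hupp s)) hL
  have hDm : D ≤ m := by nlinarith
  have hcardι : Fintype.card (MIdx n m) = N := by
    rw [Fintype.card_finset_len, Fintype.card_fin]
  have hsmall : 2 * (((Fintype.card (MIdx n m) - 1).choose (K + 1) : ℝ) *
      (D * L * (m * L) ^ K)) ≤ (δ * L) ^ (K + 1) := by
    rw [hcardι]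
    have h1 : 2 * (((N - 1).choose (K + 1) : ℝ) * (D * (m : ℝ) ^ K)) ≤ δ ^ (K + 1) := by
      refine le_of_mul_le_mul_right ?_ hden
      calc 2 * (((N - 1).choose (K + 1) : ℝ) * (D * (m : ℝ) ^ K)) *
            ((N.factorial : ℝ) * 4 ^ (K + 2))
          = δ ^ (K + 1) * (2 * (((N - 1).choose (K + 1) : ℝ) * (δ * (m : ℝ) ^ K))) := by
            linear_combination (2 * ((N - 1).choose (K + 1) : ℝ) * (m : ℝ) ^ K) * hDmul
        _ ≤ δ ^ (K + 1) * (2 * (((N - 1).choose (K + 1) : ℝ) * ((n - 1 : ℕ) : ℝ) ^ (K + 1))) := by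
            rw [pow_succ' ((n - 1 : ℕ) : ℝ) K]
            gcongr
        _ ≤ δ ^ (K + 1) * ((N.factorial : ℝ) * 4 ^ (K + 2)) := by
            refine mul_le_mul_of_nonneg_left ?_ (by positivity)
            exact_mod_cast hCt
    calc _ = 2 * (((N - 1).choose (K + 1) : ℝ) * (D * (m : ℝ) ^ K)) * L ^ (K + 1) := by ring
      _ ≤ δ ^ (K + 1) * L ^ (K + 1) := by gcongr
      _ = _ := (mul_pow _ _ _).symm
  intro i
  simp only [S_update_zero]
  set X : MIdx n m → ℝ := fun j => esymmOn (K + 1) (univ.erase j) (sumVec n m μ)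
  have hcomp : ∀ i j, δ * X j ≤ (3 * δ + 2 * (K + 1) * m) * X i := fun i j => by
    refine le_of_mul_le_mul_right ?_ hL
    have := esymmOn_erase_le (by positivity) (mul_le_mul_of_nonneg_right hDm hL.le)
      (mul_pos hδ hL) hlow' hupp hbig (by omega) hsmall i j
    linarith
  have hX0 : ∀ j, 0 ≤ X j := fun j =>
    nonneg_of_mul_nonneg_right (a := 2 * δ + 2 * (K + 1) * m) (by linarith [hcomp j j])
      (by positivity)
  have hsum : δ * ∑ j, X j ≤ N * ((m * (2 * K + 5)) * X i) := by
    rw [mul_sum, ← hcardι, ← card_univ, ← nsmul_eq_mul]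
    refine sum_le_card_nsmul _ _ _ fun j _ => (hcomp i j).trans ?_
    exact mul_le_mul_of_nonneg_right (by linarith) (hX0 i)
  have hθ : δ ^ (K + 1) / (2 ^ (K + 2) * (m : ℝ) ^ (K + 1) * (N : ℝ) ^ 3) ≤
      δ / (4 * m * (N : ℝ) ^ 3) := by
    rw [div_le_div_iff₀ (by positivity) (by positivity)]
    have h1 : δ ^ K ≤ (2 * m : ℝ) ^ K := by gcongr; linarith
    calc δ ^ (K + 1) * (4 * m * (N : ℝ) ^ 3) = δ ^ K * (δ * (4 * m * (N : ℝ) ^ 3)) := by ring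
      _ ≤ (2 * m : ℝ) ^ K * (δ * (4 * m * (N : ℝ) ^ 3)) := by gcongr
      _ = _ := by rw [mul_pow]; ring
  have hKN : (K : ℝ) + 2 ≤ N := by exact_mod_cast (by omega : K + 2 ≤ N)
  calc _ ≤ δ / (4 * m * (N : ℝ) ^ 3) * ∑ j, X j :=
        mul_le_mul_of_nonneg_right hθ (sum_nonneg fun j _ => hX0 j)
    _ = (δ * ∑ j, X j) / (4 * m * (N : ℝ) ^ 3) := by ring
    _ ≤ (4 * m * (N : ℝ) ^ 3 * X i) / (4 * m * (N : ℝ) ^ 3) := by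
        refine div_le_div_of_nonneg_right (hsum.trans ?_) (by positivity)
        have h1 : 2 * (K : ℝ) + 5 ≤ 4 * (N : ℝ) ^ 2 := by nlinarith
        have h2 : 0 ≤ N * m * X i := by have := hX0 i; positivity
        linarith [mul_le_mul_of_nonneg_left h1 h2]
    _ = X i := by field_simp
end
end
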